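/- arXiv:2501.06535 — 5 statements merged into one kernel-verified Lean document; each statement's English description precedes it below -/
import Mathlib

section
/- Let Z' and Z'' be independent random variables, each with the standard Gumbel distribution, and let a ∈ (0,1). Then the random variable max(Z' + log a, Z'' + log(1−a)) also has the standard Gumbel distribution. -/
open MeasureTheory ProbabilityTheory Real

/-- The standard Gumbel distribution `𝒢(0,1)`: the measure on `ℝ` with density
`x ↦ exp (-(x + exp (-x)))` with respect to Lebesgue measure. -/
noncomputable def gumbel : Measure ℝ :=
  (volume : Measure ℝ).withDensity (fun x => ENNReal.ofReal (Real.exp (-(x + Real.exp (-x)))))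

lemma hasDerivAt_gumbelCDF (x : ℝ) :
    HasDerivAt (fun y => Real.exp (-Real.exp (-y))) (Real.exp (-(x + Real.exp (-x)))) x := by
  refine ((hasDerivAt_neg x).exp.fun_neg).exp.congr_deriv ?_
  rw [neg_add, Real.exp_add]
  ring

lemma tendsto_gumbelCDF_atBot :
    Filter.Tendsto (fun y => Real.exp (-Real.exp (-y))) Filter.atBot (nhds 0) :=
  Real.tendsto_exp_neg_atTop_nhds_zero.comp
    (Real.tendsto_exp_atTop.comp Filter.tendsto_neg_atBot_atTop)

lemma integrableOn_gumbelDensity_Iic (x : ℝ) :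
    IntegrableOn (fun y => Real.exp (-(y + Real.exp (-y)))) (Set.Iic x) := by
  refine integrableOn_Iic_of_intervalIntegral_norm_tendsto
    (Real.exp (-Real.exp (-x)) - 0) x (a := id) (l := Filter.atBot)
    (fun y => (by fun_prop : Continuous _).integrableOn_Ioc) Filter.tendsto_id ?_
  refine (tendsto_gumbelCDF_atBot.const_sub (Real.exp (-Real.exp (-x)))).congr fun y => ?_
  simp only [Real.norm_eq_abs, Real.abs_exp, id]
  rw [intervalIntegral.integral_eq_sub_of_hasDerivAt (fun z _ => hasDerivAt_gumbelCDF z)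
    ((by fun_prop : Continuous _).intervalIntegrable _ _)]

lemma gumbel_Iic (x : ℝ) :
    gumbel (Set.Iic x) = ENNReal.ofReal (Real.exp (-Real.exp (-x))) := by
  rw [gumbel, withDensity_apply _ measurableSet_Iic,
    ← ofReal_integral_eq_lintegral_ofReal (integrableOn_gumbelDensity_Iic x)
      (Filter.Eventually.of_forall fun _ => (Real.exp_pos _).le),
    integral_Iic_of_hasDerivAt_of_tendsto' (fun y _ => hasDerivAt_gumbelCDF y)
      (integrableOn_gumbelDensity_Iic x) tendsto_gumbelCDF_atBot, sub_zero]

/-- If `Z'` and `Z''` are independent standard Gumbel random variables and `a ∈ (0,1)`,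
then `max (Z' + log a) (Z'' + log (1 - a))` is again standard Gumbel. -/
theorem gumbel_max_stable {Ω : Type*} [MeasureSpace Ω]
    [IsProbabilityMeasure (ℙ : Measure Ω)]
    (Z' Z'' : Ω → ℝ) (hZ' : Measurable Z') (hZ'' : Measurable Z'')
    (hindep : IndepFun Z' Z'' ℙ)
    (hZ'd : Measure.map Z' ℙ = gumbel) (hZ''d : Measure.map Z'' ℙ = gumbel)
    (a : ℝ) (ha : a ∈ Set.Ioo (0 : ℝ) 1) :
    Measure.map (fun ω => max (Z' ω + Real.log a) (Z'' ω + Real.log (1 - a))) ℙ = gumbel := by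
  obtain ⟨ha0, ha1⟩ := ha
  have hM : Measurable fun ω => max (Z' ω + Real.log a) (Z'' ω + Real.log (1 - a)) := by fun_prop
  refine Measure.ext_of_Iic _ _ fun x => ?_
  have hpre : (fun ω => max (Z' ω + Real.log a) (Z'' ω + Real.log (1 - a))) ⁻¹' Set.Iic x =
      Z' ⁻¹' Set.Iic (x - Real.log a) ∩ Z'' ⁻¹' Set.Iic (x - Real.log (1 - a)) := by
    ext ω
    simp [le_sub_iff_add_le]
  rw [Measure.map_apply hM measurableSet_Iic, hpre,
    hindep.measure_inter_preimage_eq_mul _ _ measurableSet_Iic measurableSet_Iic,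
    ← Measure.map_apply hZ' measurableSet_Iic, ← Measure.map_apply hZ'' measurableSet_Iic,
    hZ'd, hZ''d, gumbel_Iic, gumbel_Iic, gumbel_Iic, ← ENNReal.ofReal_mul (Real.exp_pos _).le,
    ← Real.exp_add, neg_sub, neg_sub, sub_eq_add_neg, sub_eq_add_neg (Real.log (1 - a)),
    Real.exp_add (Real.log a), Real.exp_add (Real.log (1 - a)), Real.exp_log ha0,
    Real.exp_log (sub_pos.2 ha1)]
  ring_nf
end

section
/- For every Lipschitz function f : ℝ → ℝ and every x ∈ ℝ, P_t f(x) converges, as t → ∞, to ∫_ℝ f dμ, the expectation of f under the standard Gumbel distribution; that is, the semi-group (P_t)_{t ≥ 0} is ergodic. -/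
open MeasureTheory ProbabilityTheory Real Filter Topology

/-- The operator `P_t`: `P_t f x = E[f (max (x - t) (Z + log (1 - e^{-t})))]`
where `Z` is standard Gumbel. -/
noncomputable def Pt (t : ℝ) (f : ℝ → ℝ) (x : ℝ) : ℝ :=
  ∫ z, f (max (x - t) (z + Real.log (1 - Real.exp (-t)))) ∂gumbel

/-- The Gumbel density is dominated by the Laplace profile `exp (-|x|)`. -/
lemma gumbel_density_le (x : ℝ) : Real.exp (-(x + Real.exp (-x))) ≤ Real.exp (-|x|) := by
  apply Real.exp_le_exp.mpr
  rcases le_total 0 x with h | h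
  · rw [abs_of_nonneg h]
    linarith [Real.exp_pos (-x)]
  · rw [abs_of_nonpos h]
    have := Real.quadratic_le_exp_of_nonneg (neg_nonneg.mpr h)
    nlinarith [sq_nonneg (x + 1)]

lemma one_add_abs_mul_exp_neg_abs_le (x : ℝ) :
    (1 + |x|) * Real.exp (-|x|) ≤ 6 * (1 + x ^ 2)⁻¹ := by
  have hs := abs_nonneg x
  have h := Real.sum_le_exp_of_nonneg hs 4
  simp only [Finset.sum_range_succ, Finset.sum_range_zero, Nat.factorial] at h
  norm_num at h
  have hx : (0 : ℝ) < 1 + x ^ 2 := by positivity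
  rw [Real.exp_neg, ← div_eq_mul_inv, ← div_eq_mul_inv, div_le_div_iff₀ (Real.exp_pos _) hx]
  have h3 : |x| ^ 2 = x ^ 2 := sq_abs x
  have h4 : |x| ^ 3 = |x| * x ^ 2 := by rw [← h3]; ring
  rw [h4] at h
  nlinarith [sq_nonneg x]

/-- A continuous function of at most linear growth is integrable for the Gumbel distribution. -/
lemma integrable_gumbel_of_linear_growth {g : ℝ → ℝ} (hg : Continuous g) {C : ℝ}
    (h : ∀ z, |g z| ≤ C * (1 + |z|)) : Integrable g gumbel := by
  have hC : 0 ≤ C := by simpa using (abs_nonneg _).trans (h 0)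
  have hm : Measurable fun x : ℝ => ENNReal.ofReal (Real.exp (-(x + Real.exp (-x)))) := by
    exact ENNReal.measurable_ofReal.comp (by fun_prop)
  rw [gumbel, integrable_withDensity_iff hm (by simp)]
  simp only [ENNReal.toReal_ofReal (Real.exp_pos _).le]
  refine (integrable_inv_one_add_sq.const_mul (C * 6)).mono'
    (by fun_prop) (Eventually.of_forall fun z => ?_)
  rw [Real.norm_eq_abs, abs_mul, abs_of_pos (Real.exp_pos _)]
  calc |g z| * Real.exp (-(z + Real.exp (-z)))
      ≤ (C * (1 + |z|)) * Real.exp (-|z|) := by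
        exact mul_le_mul (h z) (gumbel_density_le z) (Real.exp_pos _).le (by positivity)
    _ = C * ((1 + |z|) * Real.exp (-|z|)) := by ring
    _ ≤ C * (6 * (1 + z ^ 2)⁻¹) := by
        exact mul_le_mul_of_nonneg_left (one_add_abs_mul_exp_neg_abs_le z) hC
    _ = C * 6 * (1 + z ^ 2)⁻¹ := by ring

lemma tendsto_log_one_sub_exp_neg_atTop :
    Tendsto (fun t : ℝ => Real.log (1 - Real.exp (-t))) atTop (𝓝 0) := by
  have h : Tendsto (fun t : ℝ => 1 - Real.exp (-t)) atTop (𝓝 1) := by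
    simpa using Real.tendsto_exp_neg_atTop_nhds_zero.const_sub 1
  simpa using h.log one_ne_zero

/-- Ergodicity of the semi-group: for every Lipschitz `f` and every `x`,
`P_t f x → ∫ f dμ` as `t → ∞`, where `μ` is the standard Gumbel distribution. -/
theorem Pt_ergodic (f : ℝ → ℝ) (hf : ∃ K : NNReal, LipschitzWith K f) (x : ℝ) :
    Tendsto (fun t => Pt t f x) atTop (𝓝 (∫ z, f z ∂gumbel)) := by
  obtain ⟨K, hK⟩ := hf
  have hc := tendsto_log_one_sub_exp_neg_atTop
  have hfc := hK.continuous
  have hgrowth (y : ℝ) : |f y| ≤ |f 0| + K * |y| := by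
    have h1 := hK.dist_le_mul y 0
    rw [Real.dist_eq, Real.dist_eq, sub_zero] at h1
    linarith [abs_sub_abs_le_abs_sub (f y) (f 0)]
  have hK0 : (0 : ℝ) ≤ K := K.2
  refine tendsto_integral_filter_of_dominated_convergence
    (fun z => |f 0| + K * (|x| + |z| + 1)) ?_ ?_ ?_ ?_
  · exact Eventually.of_forall fun t => by fun_prop
  · filter_upwards [eventually_ge_atTop 0, hc.eventually (Icc_mem_nhds (a := -1) (b := 1)
      (by norm_num) (by norm_num))] with t ht hct
    refine Eventually.of_forall fun z => (hgrowth _).trans ?_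
    gcongr
    rw [abs_le]
    constructor
    · refine le_max_of_le_right ?_
      linarith [hct.1, neg_abs_le z, abs_nonneg x]
    · refine max_le ?_ ?_
      · linarith [le_abs_self x, abs_nonneg z]
      · linarith [hct.2, le_abs_self z, abs_nonneg x]
  · refine integrable_gumbel_of_linear_growth (C := |f 0| + K * (|x| + 1)) (by fun_prop)
      fun z => ?_
    rw [abs_of_nonneg (by positivity)]
    nlinarith [mul_nonneg (abs_nonneg (f 0)) (abs_nonneg z),
      mul_nonneg hK0 (mul_nonneg (abs_nonneg x) (abs_nonneg z))]
  · refine Eventually.of_forall fun z => (hfc.tendsto z).comp ?_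
    have hz : Tendsto (fun t : ℝ => z + Real.log (1 - Real.exp (-t))) atTop (𝓝 z) := by
      simpa using hc.const_add z
    refine hz.congr' ?_
    filter_upwards [eventually_ge_atTop (x - z + 1),
      hz.eventually (lt_mem_nhds (sub_one_lt z))] with t ht hzt
    exact (max_eq_right (by linarith)).symm
end

section
/- (Stein's Lemma for the Gumbel distribution.) Let X be a real random variable such that E[e^{−X}] < ∞, and let Y be a random variable with exponential distribution ℰ(1), independent of X. Then X has the standard Gumbel distribution if and only if E[f′(X)] = E[e^{−X} f′(X + Y)] for every f ∈ Lip_{[2]}(ℝ). -/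
open MeasureTheory ProbabilityTheory Real

/-- The exponential distribution `ℰ(1)`, with density `y ↦ e^{-y}` on `[0,∞)`. -/
noncomputable def expOne : Measure ℝ :=
  (volume : Measure ℝ).withDensity (exponentialPDF 1)

/-- `f ∈ Lip_{[2]}(ℝ)`: `f` is Lipschitz, differentiable, and its derivative is Lipschitz. -/
def MemLip2 (f : ℝ → ℝ) : Prop :=
  (∃ K : NNReal, LipschitzWith K f) ∧ Differentiable ℝ f ∧
    ∃ K : NNReal, LipschitzWith K (deriv f)

open Set Filter Topology

/-- Finite measures on `ℝ` that give the same integral to every bounded Lipschitz function agree. -/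
lemma MeasureTheory.Measure.ext_of_integral_bounded_lipschitz {μ ν : Measure ℝ}
    [IsFiniteMeasure μ] [IsFiniteMeasure ν]
    (h : ∀ g : ℝ → ℝ, (∃ K, LipschitzWith K g) → (∃ C, ∀ x, |g x| ≤ C) →
      ∫ x, g x ∂μ = ∫ x, g x ∂ν) : μ = ν := by
  refine Measure.ext_of_Iic μ ν fun a ↦ ?_
  have hpos (n : ℕ) : (0 : ℝ) < 1 / ((n : ℝ) + 1) := Nat.one_div_pos_of_nat
  have hlim := tendsto_one_div_add_atTop_nhds_zero_nat (𝕜 := ℝ)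
  refine tendsto_nhds_unique
    (tendsto_lintegral_thickenedIndicator_of_isClosed μ isClosed_Iic hpos hlim) ?_
  refine (tendsto_lintegral_thickenedIndicator_of_isClosed ν isClosed_Iic hpos hlim).congr
    fun n ↦ ?_
  have key := h (fun x ↦ (thickenedIndicator (hpos n) (Iic a) x : ℝ))
    ⟨_, (lipschitzWith_thickenedIndicator (hpos n) (Iic a))⟩
    ⟨1, fun x ↦ by simpa using thickenedIndicator_le_one (hpos n) (Iic a) x⟩
  have hlint (ρ : Measure ℝ) [IsFiniteMeasure ρ] :
      ∫⁻ x, (thickenedIndicator (hpos n) (Iic a) x : ENNReal) ∂ρ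
        = ENNReal.ofReal (∫ x, (thickenedIndicator (hpos n) (Iic a) x : ℝ) ∂ρ) := by
    rw [ofReal_integral_eq_lintegral_ofReal (integrable_thickenedIndicator _ _)
      (ae_of_all _ fun x ↦ NNReal.coe_nonneg _)]
    simp
  rw [hlint, hlint, key]

/-- The primitive of a bounded Lipschitz function belongs to `Lip_{[2]}(ℝ)`. -/
lemma exists_memLip2_deriv_eq {g : ℝ → ℝ} {K : NNReal} {C : ℝ} (hg : LipschitzWith K g)
    (hC : ∀ x, |g x| ≤ C) : ∃ f, MemLip2 f ∧ deriv f = g := by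
  have hd (x : ℝ) : HasDerivAt (fun u ↦ ∫ t in (0 : ℝ)..u, g t) (g x) x :=
    intervalIntegral.integral_hasDerivAt_right (hg.continuous.intervalIntegrable _ _)
      (hg.continuous.stronglyMeasurableAtFilter _ _) hg.continuous.continuousAt
  have hderiv : deriv (fun u ↦ ∫ t in (0 : ℝ)..u, g t) = g := funext fun x ↦ (hd x).deriv
  refine ⟨_, ⟨⟨C.toNNReal, ?_⟩, fun x ↦ (hd x).differentiableAt, K, by rwa [hderiv]⟩, hderiv⟩
  refine lipschitzWith_of_nnnorm_deriv_le (fun x ↦ (hd x).differentiableAt) fun x ↦ ?_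
  rw [hderiv, ← NNReal.coe_le_coe, coe_nnnorm, Real.norm_eq_abs]
  exact (hC x).trans (Real.le_coe_toNNReal C)

lemma lintegral_expOne_translate (x : ℝ) {h : ℝ → ENNReal} (hh : Measurable h) :
    ∫⁻ y, ENNReal.ofReal (rexp (-x)) * h (x + y) ∂expOne
      = ∫⁻ z, (Iic z).indicator (fun _ ↦ ENNReal.ofReal (rexp (-z)) * h z) x := by
  have hm : Measurable (exponentialPDF 1) := (measurable_exponentialPDFReal 1).ennreal_ofReal
  rw [expOne, lintegral_withDensity_eq_lintegral_mul _ hm (by fun_prop),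
    ← lintegral_add_left_eq_self
      (fun z ↦ (Iic z).indicator (fun _ ↦ ENNReal.ofReal (rexp (-z)) * h z) x) x]
  refine lintegral_congr fun y ↦ ?_
  rcases lt_or_ge y 0 with hy | hy
  · simp [exponentialPDF_of_neg hy, hy]
  · have hxy : x ∈ Iic (x + y) := by simpa using hy
    rw [Pi.mul_apply, exponentialPDF_of_nonneg hy, indicator_of_mem hxy, ← mul_assoc,
      ← ENNReal.ofReal_mul (by positivity)]
    congr 2
    rw [one_mul, one_mul, ← Real.exp_add]
    ring_nf

/-- The law of `X + Y` under the measure of density `e^{-X}`. -/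
lemma map_add_withDensity_exp_neg {Ω : Type*} [MeasurableSpace Ω] {P : Measure Ω}
    [IsProbabilityMeasure P] {X Y : Ω → ℝ} (hX : Measurable X) (hY : Measurable Y)
    (hindep : IndepFun X Y P) (hYlaw : P.map Y = expOne) :
    (P.withDensity fun ω ↦ ENNReal.ofReal (rexp (-X ω))).map (fun ω ↦ X ω + Y ω)
      = volume.withDensity fun z ↦ ENNReal.ofReal (rexp (-z) * cdf (P.map X) z) := by
  have : IsProbabilityMeasure (P.map X) := Measure.isProbabilityMeasure_map hX.aemeasurable
  have : IsProbabilityMeasure expOne := hYlaw ▸ Measure.isProbabilityMeasure_map hY.aemeasurable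
  have hcdf : Measurable (cdf (P.map X)) := (monotone_cdf _).measurable
  refine Measure.ext_of_lintegral _ fun h hh ↦ ?_
  rw [lintegral_map hh (by fun_prop),
    lintegral_withDensity_eq_lintegral_mul _ (by fun_prop) (by fun_prop),
    lintegral_withDensity_eq_lintegral_mul _ (by fun_prop) hh]
  calc ∫⁻ ω, ENNReal.ofReal (rexp (-X ω)) * h (X ω + Y ω) ∂P
      = ∫⁻ p, ENNReal.ofReal (rexp (-p.1)) * h (p.1 + p.2) ∂(P.map fun ω ↦ (X ω, Y ω)) := by
        rw [lintegral_map (by fun_prop) (by fun_prop)]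
    _ = ∫⁻ x, ∫⁻ z, (Iic z).indicator (fun _ ↦ ENNReal.ofReal (rexp (-z)) * h z) x ∂volume
          ∂(P.map X) := by
        rw [(indepFun_iff_map_prod_eq_prod_map_map hX.aemeasurable hY.aemeasurable).1 hindep,
          hYlaw, lintegral_prod _ (by fun_prop)]
        exact lintegral_congr fun x ↦ lintegral_expOne_translate x hh
    _ = ∫⁻ z, ∫⁻ x, (Iic z).indicator (fun _ ↦ ENNReal.ofReal (rexp (-z)) * h z) x ∂(P.map X) := by
        refine lintegral_lintegral_swap (Measurable.aemeasurable ?_)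
        have hset : MeasurableSet {p : ℝ × ℝ | p.1 ≤ p.2} :=
          measurableSet_le measurable_fst measurable_snd
        exact Measurable.indicator (s := {p : ℝ × ℝ | p.1 ≤ p.2})
          (f := fun p : ℝ × ℝ ↦ ENNReal.ofReal (rexp (-p.2)) * h p.2) (by fun_prop) hset
    _ = _ := by
        refine lintegral_congr fun z ↦ ?_
        rw [lintegral_indicator_const measurableSet_Iic, Pi.mul_apply,
          ENNReal.ofReal_mul (by positivity), ofReal_cdf, mul_right_comm]

lemma cdf_eq_setIntegral_of_eq_withDensity {ν : Measure ℝ} [IsProbabilityMeasure ν] {p : ℝ → ℝ}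
    (hp : Measurable p) (hp0 : ∀ x, 0 ≤ p x)
    (hν : ν = volume.withDensity fun x ↦ ENNReal.ofReal (p x)) :
    Integrable p ∧ ∀ b, cdf ν b = ∫ x in Iic b, p x := by
  have hint : Integrable p := by
    refine ⟨hp.aestronglyMeasurable, ?_⟩
    rw [hasFiniteIntegral_iff_ofReal (ae_of_all _ hp0), ← setLIntegral_univ,
      ← withDensity_apply _ MeasurableSet.univ, ← hν]
    exact measure_lt_top _ _
  refine ⟨hint, fun b ↦ ?_⟩
  rw [cdf_eq_real, measureReal_def, hν, withDensity_apply _ measurableSet_Iic,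
    ← ofReal_integral_eq_lintegral_ofReal hint.integrableOn (ae_of_all _ hp0),
    ENNReal.toReal_ofReal (setIntegral_nonneg measurableSet_Iic fun x _ ↦ hp0 x)]

lemma hasDerivAt_exp_neg_exp_neg (x : ℝ) :
    HasDerivAt (fun x ↦ rexp (-rexp (-x))) (rexp (-(x + rexp (-x)))) x := by
  have h : HasDerivAt (fun x ↦ rexp (-rexp (-x))) (rexp (-rexp (-x)) * -(rexp (-x) * -1)) x :=
    (hasDerivAt_neg x).exp.neg.exp
  convert h using 1
  rw [neg_add, Real.exp_add]
  ring

/-- The cumulative distribution function of the standard Gumbel distribution. -/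
lemma cdf_gumbel [IsProbabilityMeasure gumbel] (b : ℝ) : cdf gumbel b = rexp (-rexp (-b)) := by
  obtain ⟨hint, hcdf⟩ := cdf_eq_setIntegral_of_eq_withDensity (ν := gumbel)
    (p := fun x ↦ rexp (-(x + rexp (-x)))) (by fun_prop) (fun x ↦ (Real.exp_pos _).le) rfl
  have hlim : Tendsto (fun x : ℝ ↦ rexp (-rexp (-x))) atBot (𝓝 0) :=
    Real.tendsto_exp_atBot.comp (tendsto_neg_atTop_atBot.comp
      (Real.tendsto_exp_atTop.comp tendsto_neg_atBot_atTop))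
  rw [hcdf, integral_Iic_of_hasDerivAt_of_tendsto' (fun x _ ↦ hasDerivAt_exp_neg_exp_neg x)
    hint.integrableOn hlim, sub_zero]

/-- A distribution function with density `x ↦ e^{-x} F(x)` is that of the Gumbel distribution. -/
lemma cdf_eq_of_eq_withDensity_exp_neg_mul_cdf {ν : Measure ℝ} [IsProbabilityMeasure ν]
    (hν : ν = volume.withDensity fun z ↦ ENNReal.ofReal (rexp (-z) * cdf ν z)) (x : ℝ) :
    cdf ν x = rexp (-rexp (-x)) := by
  have hmeas : Measurable (cdf ν) := (monotone_cdf _).measurable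
  obtain ⟨hint, hcdf⟩ := cdf_eq_setIntegral_of_eq_withDensity
    (p := fun z ↦ rexp (-z) * cdf ν z) (by fun_prop)
    (fun z ↦ mul_nonneg (Real.exp_pos _).le (cdf_nonneg _ _)) hν
  have hprim : (cdf ν : ℝ → ℝ) = fun b ↦ cdf ν 0 + ∫ z in (0 : ℝ)..b, rexp (-z) * cdf ν z := by
    funext b
    rw [← intervalIntegral.integral_Iic_sub_Iic hint.integrableOn hint.integrableOn, ← hcdf,
      ← hcdf]
    ring
  have hcont : Continuous (cdf ν) := by
    rw [hprim]
    exact continuous_const.add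
      (intervalIntegral.continuous_primitive (fun _ _ ↦ hint.intervalIntegrable) 0)
  have hpcont : Continuous fun z ↦ rexp (-z) * cdf ν z := by fun_prop
  have hderiv (b : ℝ) : HasDerivAt (cdf ν) (rexp (-b) * cdf ν b) b := by
    have h := (intervalIntegral.integral_hasDerivAt_right (hpcont.intervalIntegrable 0 b)
      (hpcont.stronglyMeasurableAtFilter _ _) hpcont.continuousAt).const_add (cdf ν 0)
    rwa [← hprim] at h
  have hG (b : ℝ) : HasDerivAt (fun u ↦ cdf ν u * rexp (rexp (-u))) 0 b := by
    have h : HasDerivAt (fun u ↦ cdf ν u * rexp (rexp (-u)))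
        (rexp (-b) * cdf ν b * rexp (rexp (-b)) +
          cdf ν b * (rexp (rexp (-b)) * (rexp (-b) * -1))) b :=
      (hderiv b).mul (hasDerivAt_neg b).exp.exp
    convert h using 1
    ring
  have hconst (b : ℝ) : cdf ν b * rexp (rexp (-b)) = cdf ν x * rexp (rexp (-x)) :=
    is_const_of_deriv_eq_zero (fun u ↦ (hG u).differentiableAt) (fun u ↦ (hG u).deriv) b x
  have hlim : Tendsto (fun b ↦ cdf ν b * rexp (rexp (-b))) atTop (𝓝 (1 * rexp 0)) :=
    (tendsto_cdf_atTop ν).mul ((Real.continuous_exp.tendsto 0).comp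
      (Real.tendsto_exp_atBot.comp tendsto_neg_atTop_atBot))
  simp_rw [hconst, Real.exp_zero, mul_one] at hlim
  have hone := tendsto_nhds_unique hlim tendsto_const_nhds
  rw [Real.exp_neg]
  exact eq_inv_of_mul_eq_one_left hone.symm

/-- The Gumbel distribution is the only probability measure with density `x ↦ e^{-x} F(x)`, where
`F` is its distribution function. -/
lemma eq_gumbel_iff_eq_withDensity {ν : Measure ℝ} [IsProbabilityMeasure ν] :
    ν = gumbel ↔ ν = volume.withDensity fun z ↦ ENNReal.ofReal (rexp (-z) * cdf ν z) := by
  have key (hF : ∀ x, cdf ν x = rexp (-rexp (-x))) :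
      gumbel = volume.withDensity fun z ↦ ENNReal.ofReal (rexp (-z) * cdf ν z) := by
    simp_rw [gumbel, hF, ← Real.exp_add, neg_add]
  constructor
  · rintro rfl
    exact key cdf_gumbel
  · intro h
    exact h.trans (key (cdf_eq_of_eq_withDensity_exp_neg_mul_cdf h)).symm

/-- Stein's lemma for the Gumbel distribution: if `E[e^{-X}] < ∞` and `Y ∼ ℰ(1)` is
independent of `X`, then `X` is standard Gumbel iff
`E[f' X] = E[e^{-X} f' (X + Y)]` for every `f ∈ Lip_{[2]}(ℝ)`. -/
theorem gumbel_stein_lemma {Ω : Type*} [MeasureSpace Ω]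
    [IsProbabilityMeasure (ℙ : Measure Ω)]
    (X Y : Ω → ℝ) (hXm : Measurable X) (hYm : Measurable Y)
    (hindep : IndepFun X Y ℙ)
    (hY : Measure.map Y ℙ = expOne)
    (hint : Integrable (fun ω => Real.exp (-X ω)) ℙ) :
    Measure.map X ℙ = gumbel
      ↔ ∀ f : ℝ → ℝ, MemLip2 f →
          ∫ ω, deriv f (X ω) ∂ℙ = ∫ ω, Real.exp (-X ω) * deriv f (X ω + Y ω) ∂ℙ := by
  have : IsProbabilityMeasure (Measure.map X ℙ) :=
    Measure.isProbabilityMeasure_map hXm.aemeasurable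
  rw [eq_gumbel_iff_eq_withDensity, ← map_add_withDensity_exp_neg hXm hYm hindep hY]
  have : IsFiniteMeasure ((ℙ : Measure Ω).withDensity fun ω ↦ ENNReal.ofReal (rexp (-X ω))) :=
    isFiniteMeasure_withDensity_ofReal hint.2
  have hleft {g : ℝ → ℝ} (hg : Measurable g) :
      ∫ ω, g (X ω) ∂ℙ = ∫ x, g x ∂(Measure.map X ℙ) :=
    (integral_map hXm.aemeasurable hg.aestronglyMeasurable).symm
  have hright {g : ℝ → ℝ} (hg : Measurable g) :
      ∫ ω, rexp (-X ω) * g (X ω + Y ω) ∂ℙ = ∫ x, g x ∂(Measure.map (fun ω ↦ X ω + Y ω)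
        ((ℙ : Measure Ω).withDensity fun ω ↦ ENNReal.ofReal (rexp (-X ω)))) := by
    rw [integral_map (by fun_prop) hg.aestronglyMeasurable,
      integral_withDensity_eq_integral_toReal_smul (by fun_prop)
        (ae_of_all _ fun _ ↦ ENNReal.ofReal_lt_top)]
    simp [ENNReal.toReal_ofReal (Real.exp_pos _).le]
  constructor
  · intro h f _
    rw [hleft (measurable_deriv f), hright (measurable_deriv f), ← h]
  · intro h
    refine Measure.ext_of_integral_bounded_lipschitz ?_
    rintro g ⟨K, hK⟩ ⟨C, hC⟩
    obtain ⟨f, hf, rfl⟩ := exists_memLip2_deriv_eq hK hC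
    rw [← hleft (measurable_deriv f), ← hright (measurable_deriv f), h f hf]
end

section
/- Let Y be a random variable with exponential distribution ℰ(1) and, for n ≥ 2, set G_n := (1/n)⌈−Y/log(1−1/n)⌉. Then n·G_n has the geometric distribution on {1,2,3,...} with parameter 1/n, and E[(Y − G_n)²] ≤ 1/n², so that ‖Y − G_n‖_{L²} ≤ 1/n. -/
open MeasureTheory ProbabilityTheory Real

/-- The exponential distribution as a density against Lebesgue measure on `(0,∞)`. -/
lemma expOne_eq_withDensity_restrict :
    expOne = ((volume : Measure ℝ).restrict (Set.Ioi 0)).withDensity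
      (fun y => ENNReal.ofReal (exp (-y))) := by
  rw [← withDensity_indicator measurableSet_Ioi, expOne]
  refine withDensity_congr_ae ?_
  have h0 : ∀ᵐ y : ℝ, y ≠ 0 := by simp [ae_iff]
  filter_upwards [h0] with y hy
  rcases hy.lt_or_gt with h | h
  · rw [exponentialPDF_of_neg h, Set.indicator_of_notMem (by simpa using h.le)]
  · rw [exponentialPDF_of_nonneg h.le, Set.indicator_of_mem (by simpa using h)]
    simp

lemma expOne_Iic_zero : expOne (Set.Iic 0) = 0 := by
  rw [expOne_eq_withDensity_restrict]
  refine withDensity_absolutelyContinuous _ _ ?_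
  rw [Measure.restrict_apply measurableSet_Iic, Set.Iic_inter_Ioi, Set.Ioc_self, measure_empty]

lemma hasDerivAt_neg_exp_neg (y : ℝ) : HasDerivAt (fun y : ℝ => -exp (-y)) (exp (-y)) y := by
  refine ((hasDerivAt_id y).fun_neg.exp).fun_neg.congr_deriv ?_
  simp

lemma expOne_Ioc {a b : ℝ} (ha : 0 ≤ a) (hab : a ≤ b) :
    expOne (Set.Ioc a b) = ENNReal.ofReal (exp (-a) - exp (-b)) := by
  have hint : IntervalIntegrable (fun y => exp (-y)) volume a b :=
    (by fun_prop : Continuous fun y : ℝ => exp (-y)).intervalIntegrable _ _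
  rw [expOne_eq_withDensity_restrict, withDensity_apply _ measurableSet_Ioc,
    Measure.restrict_restrict measurableSet_Ioc,
    Set.inter_eq_left.2 (Set.Ioc_subset_Ioi_self.trans (Set.Ioi_subset_Ioi ha)),
    ← ofReal_integral_eq_lintegral_ofReal
      ((intervalIntegrable_iff_integrableOn_Ioc_of_le hab).1 hint)
      (.of_forall fun y => (exp_pos _).le),
    ← intervalIntegral.integral_of_le hab,
    intervalIntegral.integral_eq_sub_of_hasDerivAt (fun y _ => hasDerivAt_neg_exp_neg y) hint]
  congr 1
  ring

lemma integral_expOne (f : ℝ → ℝ) :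
    ∫ y, f y ∂expOne = ∫ y in Set.Ioi 0, exp (-y) * f y := by
  rw [expOne_eq_withDensity_restrict, integral_withDensity_eq_integral_toReal_smul (by fun_prop)
    (.of_forall fun y => ENNReal.ofReal_lt_top)]
  simp [ENNReal.toReal_ofReal (exp_pos _).le]

lemma integral_exp_neg_mul_sub_sq (a b c : ℝ) :
    ∫ y in a..b, exp (-y) * (y - c) ^ 2 =
      exp (-a) * ((a - c) ^ 2 + 2 * (a - c) + 2) -
        exp (-b) * ((b - c) ^ 2 + 2 * (b - c) + 2) := by
  have hderiv : ∀ y ∈ Set.uIcc a b,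
      HasDerivAt (fun y => -exp (-y) * ((y - c) ^ 2 + 2 * (y - c) + 2))
        (exp (-y) * (y - c) ^ 2) y := by
    intro y _
    have h1 : HasDerivAt (fun y : ℝ => y - c) 1 y := (hasDerivAt_id y).sub_const c
    refine ((hasDerivAt_neg_exp_neg y).fun_mul
      (((h1.fun_pow 2).fun_add (h1.const_mul 2)).add_const 2)).congr_deriv ?_
    push_cast
    ring
  rw [intervalIntegral.integral_eq_sub_of_hasDerivAt hderiv
    ((by fun_prop : Continuous fun y : ℝ => exp (-y) * (y - c) ^ 2).intervalIntegrable _ _)]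
  ring

lemma ceil_div_eq_iff_mem_Ioc {l : ℝ} (hl : 0 < l) (y : ℝ) (k : ℤ) :
    ⌈y / l⌉ = k ↔ y ∈ Set.Ioc ((k - 1) * l) (k * l) := by
  rw [Int.ceil_eq_iff, lt_div_iff₀ hl, div_le_iff₀ hl, Set.mem_Ioc]

lemma exp_neg_natCast_mul {l q : ℝ} (hq : exp (-l) = q) (k : ℕ) : exp (-(k * l)) = q ^ k := by
  rw [← hq, ← exp_nat_mul, mul_neg]

lemma expOne_ceil_div_eq {l q : ℝ} (hl : 0 < l) (hq : exp (-l) = q) (k : ℕ) :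
    expOne {y | ⌈y / l⌉ = (k : ℤ)} =
      ENNReal.ofReal (if 1 ≤ k then q ^ (k - 1) * (1 - q) else 0) := by
  have hset : {y | ⌈y / l⌉ = (k : ℤ)} = Set.Ioc (((k : ℝ) - 1) * l) (k * l) := by
    ext y
    simpa using ceil_div_eq_iff_mem_Ioc hl y k
  rw [hset]
  rcases k with _ | k
  · simpa using measure_mono_null (fun y hy => by simpa using hy.2) expOne_Iic_zero
  · rw [expOne_Ioc (by push_cast; rw [add_sub_cancel_right]; positivity) (by nlinarith),
      exp_neg_natCast_mul hq]
    push_cast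
    rw [add_sub_cancel_right, exp_neg_natCast_mul hq]
    congr 1
    ring

lemma integral_exp_neg_mul_sub_ceil_sq {l n : ℝ} (hl : 0 < l) (hn : n ≠ 0)
    (hq : exp (-l) = 1 - 1 / n)
    (hint : IntegrableOn (fun y => exp (-y) * (y - (⌈y / l⌉ : ℝ) / n) ^ 2) (Set.Ioi 0))
    (N : ℕ) :
    ∫ y in (0 : ℝ)..N * l, exp (-y) * (y - (⌈y / l⌉ : ℝ) / n) ^ 2 =
      (2 - 1 / n - 2 * l * (n - 1)) -
        (1 - 1 / n) ^ N * ((2 - 1 / n - 2 * l * (n - 1)) + N ^ 2 * (l - 1 / n) ^ 2) := by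
  have hii : ∀ a b : ℝ, 0 ≤ a → a ≤ b → IntervalIntegrable
      (fun y => exp (-y) * (y - (⌈y / l⌉ : ℝ) / n) ^ 2) volume a b := fun a b ha hab =>
    (intervalIntegrable_iff_integrableOn_Ioc_of_le hab).2
      (hint.mono_set fun y hy => lt_of_le_of_lt ha hy.1)
  induction N with
  | zero => simp
  | succ N ih =>
    have hle : (N : ℝ) * l ≤ (N + 1 : ℕ) * l := by push_cast; nlinarith
    have hpiece : ∫ y in (N * l : ℝ)..(N + 1 : ℕ) * l,
        exp (-y) * (y - (⌈y / l⌉ : ℝ) / n) ^ 2 =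
        ∫ y in (N * l : ℝ)..(N + 1 : ℕ) * l, exp (-y) * (y - ((N : ℝ) + 1) / n) ^ 2 := by
      refine intervalIntegral.integral_congr_ae (.of_forall fun y hy => ?_)
      rw [Set.uIoc_of_le hle] at hy
      have : ⌈y / l⌉ = ((N + 1 : ℕ) : ℤ) := (ceil_div_eq_iff_mem_Ioc hl y _).2 (by simpa using hy)
      simp [this]
    rw [← intervalIntegral.integral_add_adjacent_intervals (hii 0 _ le_rfl (by positivity))
      (hii _ _ (by positivity) hle), ih, hpiece, integral_exp_neg_mul_sub_sq,
      exp_neg_natCast_mul hq, exp_neg_natCast_mul hq, pow_succ (1 - 1 / n) N]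
    push_cast
    generalize (1 - 1 / n) ^ N = Q
    field_simp
    ring

lemma add_half_sq_le_neg_log_one_sub {x : ℝ} (h0 : 0 ≤ x) (h1 : x < 1) :
    x + x ^ 2 / 2 ≤ -log (1 - x) := by
  have h := sum_le_hasSum (Finset.range 2) (fun i _ => by positivity)
    (hasSum_pow_div_log_of_abs_lt_one (abs_lt.2 ⟨by linarith, h1⟩))
  norm_num [Finset.sum_range_succ] at h
  linarith

lemma integral_expOne_sub_ceil_sq_le {l n : ℝ} (hn : 1 < n) (hq : exp (-l) = 1 - 1 / n) :
    ∫ y, (y - (⌈y / l⌉ : ℝ) / n) ^ 2 ∂expOne ≤ 1 / n ^ 2 := by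
  have hn0 : 0 < n := by linarith
  have hp0 : 0 < 1 / n := by positivity
  have hp1 : 1 / n < 1 := (div_lt_one hn0).2 hn
  have hlog : 1 / n + (1 / n) ^ 2 / 2 ≤ l := by
    have h := add_half_sq_le_neg_log_one_sub hp0.le hp1
    rwa [← hq, log_exp, neg_neg] at h
  have hl : 0 < l := by nlinarith
  have hC : 2 - 1 / n - 2 * l * (n - 1) ≤ 1 / n ^ 2 := by
    have h : (1 / n + (1 / n) ^ 2 / 2) * (2 * (n - 1)) ≤ l * (2 * (n - 1)) := by
      gcongr
    have h' : (1 / n + (1 / n) ^ 2 / 2) * (2 * (n - 1)) = 2 - 1 / n - 1 / n ^ 2 := by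
      field_simp
      ring
    linarith
  rw [integral_expOne]
  by_cases hint : IntegrableOn (fun y => exp (-y) * (y - (⌈y / l⌉ : ℝ) / n) ^ 2) (Set.Ioi 0)
  · refine le_of_tendsto (intervalIntegral_tendsto_integral_Ioi 0 hint
      (tendsto_natCast_atTop_atTop.atTop_mul_const hl)) (.of_forall fun N => ?_)
    rw [integral_exp_neg_mul_sub_ceil_sq hl hn0.ne' hq hint]
    have hQ0 : 0 ≤ (1 - 1 / n) ^ N := pow_nonneg (by linarith) N
    have hQ1 : (1 - 1 / n) ^ N ≤ 1 := pow_le_one₀ (by linarith) (by linarith)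
    have hR : 0 ≤ (1 - 1 / n) ^ N * (N ^ 2 * (l - 1 / n) ^ 2) := by positivity
    have hn2 : 0 ≤ 1 / n ^ 2 := by positivity
    nlinarith [mul_le_mul_of_nonneg_right hC (sub_nonneg.2 hQ1), mul_nonneg hQ0 hn2]
  · rw [integral_undef hint]
    positivity

/-- Let `Y ∼ ℰ(1)` and, for `n ≥ 2`, `G_n := (1/n) ⌈-Y / log (1 - 1/n)⌉`. Then `n G_n` is
geometric on `{1,2,…}` with parameter `1/n`, `E[(Y - G_n)²] ≤ 1/n²`, and
`‖Y - G_n‖_{L²} ≤ 1/n`. -/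
theorem exp_geom_coupling {Ω : Type*} [MeasureSpace Ω]
    [IsProbabilityMeasure (ℙ : Measure Ω)]
    (Y : Ω → ℝ) (hYm : Measurable Y) (hY : Measure.map Y ℙ = expOne)
    (n : ℕ) (hn : 2 ≤ n) :
    (∀ k : ℕ,
      ℙ {ω | ⌈-Y ω / Real.log (1 - 1 / (n : ℝ))⌉ = (k : ℤ)}
        = ENNReal.ofReal
            (if 1 ≤ k then (1 - 1 / (n : ℝ)) ^ (k - 1) * (1 / (n : ℝ)) else 0))
      ∧ (∫ ω, (Y ω - (⌈-Y ω / Real.log (1 - 1 / (n : ℝ))⌉ : ℝ) / n) ^ 2 ∂ℙ)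
          ≤ 1 / (n : ℝ) ^ 2
      ∧ Real.sqrt (∫ ω, (Y ω - (⌈-Y ω / Real.log (1 - 1 / (n : ℝ))⌉ : ℝ) / n) ^ 2 ∂ℙ)
          ≤ 1 / (n : ℝ) := by
  have hn1 : (1 : ℝ) < n := by exact_mod_cast hn
  have hp0 : 0 < 1 / (n : ℝ) := by positivity
  have hp1 : 1 / (n : ℝ) < 1 := (div_lt_one (by linarith)).2 hn1
  have hq : exp (-(-log (1 - 1 / (n : ℝ)))) = 1 - 1 / (n : ℝ) := by
    rw [neg_neg, exp_log (by linarith)]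
  have hl : 0 < -log (1 - 1 / (n : ℝ)) := neg_pos.2 (log_neg (by linarith) (by linarith))
  have hsq : ∫ ω, (Y ω - (⌈-Y ω / Real.log (1 - 1 / (n : ℝ))⌉ : ℝ) / n) ^ 2 ∂ℙ
      ≤ 1 / (n : ℝ) ^ 2 := by
    have h := integral_expOne_sub_ceil_sq_le hn1 hq
    rw [← hY, integral_map hYm.aemeasurable
      (by fun_prop : Measurable _).aestronglyMeasurable] at h
    simpa only [neg_div, div_neg] using h
  refine ⟨fun k => ?_, hsq, ?_⟩
  · have h := expOne_ceil_div_eq hl hq k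
    have hmeas : MeasurableSet {y : ℝ | ⌈y / -log (1 - 1 / (n : ℝ))⌉ = (k : ℤ)} :=
      (by fun_prop : Measurable fun y : ℝ => ⌈y / -log (1 - 1 / (n : ℝ))⌉)
        (measurableSet_singleton (k : ℤ))
    rw [← hY, Measure.map_apply hYm hmeas] at h
    simpa only [neg_div, div_neg, sub_sub_cancel, Set.preimage_ofPred_eq] using h
  · refine Real.sqrt_le_iff.2 ⟨hp0.le, ?_⟩
    rwa [div_pow, one_pow]
end

section
/- Let t > 0, set γ_t := e^t − 1, let Y be a random variable with exponential distribution ℰ(1), and let h : ℝ → ℝ be differentiable with |h′| ≤ 1 everywhere. Then the function g(x) := e^{−x} E[e^{−γ_t e^{−(x+Y)}} h′(x + Y − t)] = ∫_x^∞ e^{−z} e^{−γ_t e^{−z}} h′(z − t) dz is Lipschitz with Lipschitz constant at most (e γ_t)^{−1}; indeed g is differentiable with g′(x) = −e^{−x} e^{−γ_t e^{−x}} h′(x − t) and |g′(x)| ≤ e^{−1}/γ_t for all x ∈ ℝ. -/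
open MeasureTheory ProbabilityTheory Real

/-- The expectation of a function of a shifted `ℰ(1)` variable, as an integral over a half-line. -/
theorem exp_neg_mul_integral_expOne (F : ℝ → ℝ) (x : ℝ) :
    Real.exp (-x) * ∫ y, F (x + y) ∂expOne = ∫ z in Set.Ioi x, Real.exp (-z) * F z := by
  have hpdf : Measurable (exponentialPDF 1) :=
    (measurable_exponentialPDFReal 1).ennreal_ofReal
  rw [expOne, integral_withDensity_eq_integral_toReal_smul hpdf
    (ae_of_all _ fun y => by simp [exponentialPDF_eq]),
    ← integral_indicator measurableSet_Ioi, ← integral_const_mul,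
    ← integral_add_left_eq_self ((Set.Ioi x).indicator fun z => Real.exp (-z) * F z) x]
  refine integral_congr_ae ?_
  have h0 : ∀ᵐ y : ℝ, y ≠ 0 := by simp [ae_iff]
  filter_upwards [h0] with y hy
  rw [exponentialPDF_eq]
  rcases lt_or_gt_of_ne hy with hneg | hpos
  · simp [not_le.mpr hneg, hneg.le]
  · have : (0 : ℝ) ≤ Real.exp (-y) := (Real.exp_pos _).le
    simp [hpos.le, hpos, ENNReal.toReal_ofReal this, Real.exp_add]
    ring

/-- An integrable derivative, weighted by a `C¹` function, is recovered from its tail integral at every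
point, even where it fails to be continuous. -/
theorem hasDerivAt_setIntegral_Ioi_mul_deriv {φ φ' h : ℝ → ℝ}
    (hφ : ∀ x, HasDerivAt φ (φ' x) x) (hφ' : Continuous φ') (hdiff : Differentiable ℝ h)
    (hint : ∀ x, IntegrableOn (fun z => φ z * deriv h z) (Set.Ioi x)) (x : ℝ) :
    HasDerivAt (fun x => ∫ z in Set.Ioi x, φ z * deriv h z) (-(φ x * deriv h x)) x := by
  set H : ℝ → ℝ := fun x => φ x * h x - ∫ z in (0 : ℝ)..x, φ' z * h z
  have hH : ∀ x, HasDerivAt H (φ x * deriv h x) x := fun x => by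
    refine (((hφ x).mul (hdiff x).hasDerivAt).sub
      ((hφ'.mul hdiff.continuous).integral_hasStrictDerivAt 0 x).hasDerivAt).congr_deriv ?_
    simp
  have hsplit : ∀ x, ∫ z in Set.Ioi x, φ z * deriv h z
      = (∫ z in Set.Ioi 0, φ z * deriv h z) + H 0 - H x := fun x => by
    have hsub := intervalIntegral.integral_Ioi_sub_Ioi' (hint x) (hint 0)
    rw [intervalIntegral.integral_eq_sub_of_hasDerivAt (fun z _ => hH z)
      (intervalIntegrable_iff.mpr ((hint (min x 0)).mono_set Set.Ioc_subset_Ioi_self))] at hsub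
    linarith
  rw [funext hsplit]
  exact (hH x).const_sub _

/-- The function `u ↦ u e^{-γ u}` is at most `e^{-1} / γ`. -/
theorem mul_exp_neg_mul_le {γ : ℝ} (hγ : 0 < γ) (u : ℝ) :
    u * Real.exp (-γ * u) ≤ Real.exp (-1) / γ := by
  rw [le_div_iff₀ hγ]
  calc u * Real.exp (-γ * u) * γ = (γ * u - 1 + 1) * Real.exp (-γ * u) := by ring
    _ ≤ Real.exp (γ * u - 1) * Real.exp (-γ * u) := by
      gcongr; exact Real.add_one_le_exp _
    _ = Real.exp (-1) := by rw [← Real.exp_add]; ring_nf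

/-- Let `t > 0`, `γ_t = e^t - 1`, `Y ∼ ℰ(1)` and `h` differentiable with `|h'| ≤ 1`. Then
`g x := e^{-x} E[e^{-γ_t e^{-(x+Y)}} h'(x+Y-t)] = ∫_x^∞ e^{-z} e^{-γ_t e^{-z}} h'(z-t) dz`
is differentiable with `g' x = -e^{-x} e^{-γ_t e^{-x}} h'(x-t)`, `|g' x| ≤ e^{-1}/γ_t`, and
`g` is `(e γ_t)⁻¹`-Lipschitz. -/
theorem g_lipschitz {Ω : Type*} [MeasureSpace Ω]
    [IsProbabilityMeasure (ℙ : Measure Ω)]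
    (Y : Ω → ℝ) (hYm : Measurable Y) (hY : Measure.map Y ℙ = expOne)
    (t : ℝ) (ht : 0 < t)
    (h : ℝ → ℝ) (hdiff : Differentiable ℝ h) (hbd : ∀ x, |deriv h x| ≤ 1)
    (g : ℝ → ℝ)
    (hg : ∀ x, g x = Real.exp (-x)
      * ∫ ω, Real.exp (-(Real.exp t - 1) * Real.exp (-(x + Y ω)))
          * deriv h (x + Y ω - t) ∂ℙ) :
    (∀ x, g x = ∫ z in Set.Ioi x,
        Real.exp (-z) * Real.exp (-(Real.exp t - 1) * Real.exp (-z)) * deriv h (z - t))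
      ∧ (∀ x, HasDerivAt g
          (-(Real.exp (-x) * Real.exp (-(Real.exp t - 1) * Real.exp (-x))
              * deriv h (x - t))) x)
      ∧ (∀ x, |deriv g x| ≤ Real.exp (-1) / (Real.exp t - 1))
      ∧ LipschitzWith (Real.toNNReal (Real.exp 1 * (Real.exp t - 1))⁻¹) g := by
  have hγ : 0 < Real.exp t - 1 := sub_pos.mpr (Real.one_lt_exp_iff.mpr ht)
  set γ := Real.exp t - 1
  set φ : ℝ → ℝ := fun z => Real.exp (-z) * Real.exp (-γ * Real.exp (-z)) with hφdef
  have hshift : ∀ x, deriv (fun z => h (z - t)) x = deriv h (x - t) := fun x =>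
    deriv_comp_sub_const h t x
  have hmeas : Measurable fun z => deriv h (z - t) :=
    (measurable_deriv h).comp (measurable_id.sub_const t)
  have hφm : Measurable φ := by fun_prop
  have hg' : ∀ x, g x = ∫ z in Set.Ioi x, φ z * deriv h (z - t) := fun x => by
    set F : ℝ → ℝ := fun z => Real.exp (-γ * Real.exp (-z)) * deriv h (z - t)
    have hF : Measurable fun y => F (x + y) := by
      have : Measurable F := by fun_prop
      fun_prop
    have hmap : ∫ y, F (x + y) ∂expOne = ∫ ω, F (x + Y ω) ∂ℙ := by
      rw [← hY, integral_map hYm.aemeasurable hF.aestronglyMeasurable]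
    rw [hg x, ← hmap, exp_neg_mul_integral_expOne F x]
    simp only [F, hφdef, mul_assoc]
  have hint : ∀ x, IntegrableOn (fun z => φ z * deriv (fun z => h (z - t)) z) (Set.Ioi x) := by
    intro x
    simp only [hshift]
    refine Integrable.mono' (integrableOn_exp_neg_Ioi x)
      (hφm.mul hmeas).aestronglyMeasurable (ae_of_all _ fun z => ?_)
    have hexp : Real.exp (-γ * Real.exp (-z)) ≤ 1 :=
      Real.exp_le_one_iff.mpr (by have := mul_pos hγ (Real.exp_pos (-z)); linarith)
    rw [Real.norm_eq_abs, abs_mul, abs_of_pos (by positivity : 0 < φ z)]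
    calc φ z * |deriv h (z - t)| ≤ Real.exp (-z) * 1 * 1 := by
          have := hbd (z - t)
          gcongr
          exact mul_le_mul_of_nonneg_left hexp (Real.exp_pos _).le
      _ = Real.exp (-z) := by ring
  have hφ : ∀ x, HasDerivAt φ (-φ x + γ * Real.exp (-x) * φ x) x := fun x => by
    have he : HasDerivAt (fun z : ℝ => Real.exp (-z)) (-Real.exp (-x)) x := by
      simpa using (hasDerivAt_neg x).exp
    refine (he.mul (he.const_mul (-γ)).exp).congr_deriv ?_
    simp only [hφdef]
    ring
  have hderiv : ∀ x, HasDerivAt g (-(φ x * deriv h (x - t))) x := fun x => by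
    have := hasDerivAt_setIntegral_Ioi_mul_deriv hφ (by fun_prop)
      (hdiff.comp (differentiable_id.sub_const t)) hint x
    simp only [Function.comp_def, id, hshift] at this
    rwa [← funext hg'] at this
  have hbound : ∀ x, |deriv g x| ≤ Real.exp (-1) / γ := fun x => by
    rw [(hderiv x).deriv, abs_neg, abs_mul, abs_of_pos (by positivity : 0 < φ x)]
    calc φ x * |deriv h (x - t)| ≤ φ x * 1 := by
          have := hbd (x - t)
          gcongr
      _ ≤ Real.exp (-1) / γ := by
          rw [mul_one]
          exact mul_exp_neg_mul_le hγ _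
  refine ⟨hg', hderiv, hbound, lipschitzWith_of_nnnorm_deriv_le
    (fun x => (hderiv x).differentiableAt) fun x => ?_⟩
  rw [← NNReal.coe_le_coe, coe_nnnorm, Real.norm_eq_abs, Real.coe_toNNReal _ (by positivity),
    mul_inv, ← Real.exp_neg, ← div_eq_mul_inv]
  exact hbound x
end
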